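/- arXiv:1908.05018 — 8 statements merged into one kernel-verified Lean document; each statement's English description precedes it below -/
import Mathlib

section
/- Let m and n be coprime positive integers and let c be a nonzero complex number. Then the polynomial x^m − c·y^n is irreducible in ℂ[x,y]. -/
open MvPolynomial

/-- A Capelli-type criterion over a domain. -/
lemma irreducible_aux {R : Type*} [CommRing R] [IsDomain R] (m : ℕ) (hm : 0 < m) (a : R)
    (h : ∀ (b : R) (k : ℕ), b ^ m = ((-1) ^ k) ^ m * a ^ k → m ∣ k) :
    Irreducible (Polynomial.X ^ m - Polynomial.C a : Polynomial R) := by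
  have hmon : (Polynomial.X ^ m - Polynomial.C a : Polynomial R).Monic :=
    Polynomial.monic_X_pow_sub_C a hm.ne'
  have hdeg : (Polynomial.X ^ m - Polynomial.C a : Polynomial R).natDegree = m :=
    Polynomial.natDegree_X_pow_sub_C
  rw [hmon.irreducible_iff_natDegree']
  refine ⟨fun h1 => ?_, fun f g hf hg hfg hmem => ?_⟩
  · rw [h1, Polynomial.natDegree_one] at hdeg
    omega
  rw [hdeg, Finset.mem_Ioc] at hmem
  have key : m ∣ g.natDegree := by
    apply h (g.coeff 0)
    let K := AlgebraicClosure (FractionRing R)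
    let φ : R →+* K := (algebraMap (FractionRing R) K).comp (algebraMap R (FractionRing R))
    have hφ : Function.Injective φ :=
      (algebraMap (FractionRing R) K).injective.comp (IsFractionRing.injective R (FractionRing R))
    apply hφ
    have hs : (g.map φ).Splits := IsAlgClosed.splits _
    have hgm : (g.map φ).Monic := hg.map φ
    have h0 : φ (g.coeff 0) = (-1) ^ g.natDegree * (g.map φ).roots.prod := by
      rw [← Polynomial.coeff_map, hs.coeff_zero_eq_prod_roots_of_monic hgm, hg.natDegree_map]
    have hr : ∀ r ∈ (g.map φ).roots, r ^ m = φ a := by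
      intro r hr
      have h2 := (Polynomial.mem_roots'.1 hr).2
      have h3 := congrArg (fun p => (p.map φ).eval r) hfg
      simp only [Polynomial.map_mul, Polynomial.eval_mul, h2.eq_zero] at h3
      simp at h3
      exact (sub_eq_zero.1 h3.symm)
    have hprod : (g.map φ).roots.prod ^ m = φ a ^ g.natDegree := by
      have hp : (g.map φ).roots.prod ^ m = ((g.map φ).roots.map (fun r => r ^ m)).prod := by
        rw [Multiset.prod_map_pow, Multiset.map_id']
      rw [hp, Multiset.map_congr rfl hr, Multiset.map_const',
        Multiset.prod_replicate, ← hs.natDegree_eq_card_roots, hg.natDegree_map]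
    rw [map_pow, h0, mul_pow, hprod]
    simp
  have := Nat.le_of_dvd hmem.1 key
  omega

/-- Let `m` and `n` be coprime positive integers and `c` a nonzero complex number.
Then `x^m - c * y^n` is irreducible in `ℂ[x,y]`. -/
theorem stmt_0 (m n : ℕ) (hm : 0 < m) (hn : 0 < n) (hmn : Nat.Coprime m n)
    (c : ℂ) (hc : c ≠ 0) :
    Irreducible ((X 0) ^ m - C c * (X 1) ^ n : MvPolynomial (Fin 2) ℂ) := by
  rw [← MulEquiv.irreducible_iff (finSuccEquiv ℂ 1)]
  have e : finSuccEquiv ℂ 1 ((X 0) ^ m - C c * (X 1) ^ n) =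
      Polynomial.X ^ m - Polynomial.C (C c * (X 0) ^ n) := by
    have h1 : finSuccEquiv ℂ 1 (X 1) = Polynomial.C (X 0) := finSuccEquiv_X_succ (j := 0)
    have h2 : finSuccEquiv ℂ 1 (C c) = Polynomial.C (C c) := by simp [finSuccEquiv_apply]
    rw [map_sub, map_mul, map_pow, map_pow, h1, h2, finSuccEquiv_X_zero, Polynomial.C_mul,
      Polynomial.C_pow]
  rw [e]
  apply irreducible_aux m hm
  intro b k hb
  -- evaluate into one-variable polynomials and compare degrees
  have h2 := congrArg (fun p => (aeval (fun _ => (Polynomial.X : Polynomial ℂ)) p).natDegree) hb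
  have h3 : ((-1 : Polynomial ℂ) ^ k) ^ m = Polynomial.C (((-1) ^ k) ^ m) := by simp
  simp only [map_mul, map_pow, map_neg, map_one, aeval_X, Polynomial.natDegree_pow,
    ← algebraMap_eq, AlgHom.commutes] at h2
  rw [h3, Polynomial.natDegree_C_mul (by simp), Polynomial.natDegree_pow,
    Polynomial.algebraMap_eq, Polynomial.natDegree_C_mul hc, Polynomial.natDegree_X_pow] at h2
  exact hmn.dvd_of_dvd_mul_right (Dvd.intro _ h2)
end

section
/- Let m and n be coprime positive integers, let d be a positive integer, and let ω ∈ ℂ be a primitive d-th root of unity. Then x^{md} − y^{nd} = ∏_{i=0}^{d−1} (x^m − ω^i y^n) in ℂ[x,y], and moreover every divisor of x^{md} − y^{nd} in ℂ[x,y] is equal to c·∏_{i∈S} (x^m − ω^i y^n) for some nonzero constant c ∈ ℂ and some subset S ⊆ {0, 1, …, d−1}. -/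
open MvPolynomial

lemma aux_zero (m n : ℕ) (hm : 0 < m) (hmn : Nat.Coprime m n) (α : ℂ) (hα : α ≠ 0)
    (r : Polynomial (Polynomial ℂ)) (hr : r.natDegree < m)
    (h : r.eval₂ ((Polynomial.expand ℂ m : Polynomial ℂ →ₐ[ℂ] Polynomial ℂ) : Polynomial ℂ →+* Polynomial ℂ)
      (Polynomial.C α * Polynomial.X ^ n) = 0) : r = 0 := by
  ext i0 j0
  by_cases hi : i0 < m
  swap
  · rw [Polynomial.coeff_eq_zero_of_natDegree_lt (p := r) (n := i0) (by omega)]; simp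
  rw [Polynomial.eval₂_eq_sum_range' _ hr] at h
  have h2 := congrArg (fun q => Polynomial.coeff q (j0 * m + n * i0)) h
  simp only [Polynomial.finsetSum_coeff, Polynomial.coeff_zero] at h2
  have key : ∀ i ∈ Finset.range m, i ≠ i0 →
      (((Polynomial.expand ℂ m : Polynomial ℂ →ₐ[ℂ] Polynomial ℂ) : Polynomial ℂ →+* Polynomial ℂ)
        (r.coeff i) * (Polynomial.C α * Polynomial.X ^ n) ^ i).coeff (j0 * m + n * i0) = 0 := by
    intro i hi' hne
    rw [Finset.mem_range] at hi'
    rw [mul_pow, ← pow_mul, ← Polynomial.C_pow, mul_left_comm, Polynomial.coeff_C_mul,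
      Polynomial.coeff_mul_X_pow']
    split_ifs with hle
    · have : ¬ m ∣ (j0 * m + n * i0 - n * i) := by
        intro hd
        apply hne
        have hd' : (m : ℤ) ∣ n * ((i0 : ℤ) - i) := by
          have := Int.natCast_dvd_natCast.mpr hd
          rw [Nat.cast_sub hle] at this
          push_cast at this
          have h3 := dvd_sub this (dvd_mul_left (m : ℤ) j0)
          have h4 : (n : ℤ) * ((i0 : ℤ) - i) = j0 * m + n * i0 - n * i - j0 * m := by ring
          rw [h4]; exact h3
        have hd2 : (m : ℤ) ∣ ((i0 : ℤ) - i) :=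
          IsCoprime.dvd_of_dvd_mul_left (Nat.isCoprime_iff_coprime.mpr hmn) hd'
        have := Int.eq_zero_of_abs_lt_dvd hd2 (by rw [abs_lt]; constructor <;> omega)
        omega
      simp [Polynomial.coeff_expand hm, this]
    · simp
  rw [Finset.sum_eq_single i0 key (by simp [hi])] at h2
  rw [mul_pow, ← pow_mul, ← Polynomial.C_pow, mul_left_comm, Polynomial.coeff_C_mul,
      Polynomial.coeff_mul_X_pow] at h2
  simpa [Polynomial.coeff_expand hm, hα, hm] using h2

lemma aux_prime (m n : ℕ) (hm : 0 < m) (hn : 0 < n) (hmn : Nat.Coprime m n) (a : ℂ) (ha : a ≠ 0) :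
    Prime ((X 0) ^ m - C a * (X 1) ^ n : MvPolynomial (Fin 2) ℂ) := by
  obtain ⟨α, rfl⟩ := IsAlgClosed.exists_pow_nat_eq a hm
  have hα : α ≠ 0 := by rintro rfl; simp [hm.ne'] at ha
  let φ : MvPolynomial (Fin 2) ℂ →ₐ[ℂ] Polynomial ℂ :=
    aeval ![Polynomial.C α * Polynomial.X ^ n, Polynomial.X ^ m]
  let ψ : Polynomial (Polynomial ℂ) →+* MvPolynomial (Fin 2) ℂ :=
    Polynomial.eval₂RingHom
      ((Polynomial.aeval (X 1 : MvPolynomial (Fin 2) ℂ) : Polynomial ℂ →ₐ[ℂ] _) : Polynomial ℂ →+* _)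
      (X 0)
  have hψ : Function.Surjective ψ := by
    intro f
    induction f using MvPolynomial.induction_on with
    | C c => exact ⟨Polynomial.C (Polynomial.C c), by simp [ψ, MvPolynomial.algebraMap_eq]⟩
    | add p q hp hq =>
      obtain ⟨P, rfl⟩ := hp
      obtain ⟨Q, rfl⟩ := hq
      exact ⟨P + Q, map_add _ _ _⟩
    | mul_X p i hp =>
      obtain ⟨P, rfl⟩ := hp
      fin_cases i
      · exact ⟨P * Polynomial.X, by simp [ψ]⟩
      · exact ⟨P * Polynomial.C Polynomial.X, by simp [ψ]⟩
  have hφψ : ∀ r, φ (ψ r) = r.eval₂ ((Polynomial.expand ℂ m : Polynomial ℂ →ₐ[ℂ] Polynomial ℂ) :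
      Polynomial ℂ →+* Polynomial ℂ) (Polynomial.C α * Polynomial.X ^ n) := by
    intro r
    have : (φ : MvPolynomial (Fin 2) ℂ →+* Polynomial ℂ).comp ψ = Polynomial.eval₂RingHom
        ((Polynomial.expand ℂ m : Polynomial ℂ →ₐ[ℂ] Polynomial ℂ) :
        Polynomial ℂ →+* Polynomial ℂ) (Polynomial.C α * Polynomial.X ^ n) := by
      ext <;> simp [φ, ψ, MvPolynomial.algebraMap_eq]
    exact congrArg (fun g => g r) this
  have hφp : φ ((X 0) ^ m - C (α ^ m) * (X 1) ^ n) = 0 := by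
    simp [φ, MvPolynomial.algebraMap_eq, ← pow_mul, mul_pow, mul_comm m n]
  have hker : ∀ f, φ f = 0 → ((X 0) ^ m - C (α ^ m) * (X 1) ^ n) ∣ f := by
    intro f hf
    obtain ⟨F, rfl⟩ := hψ f
    set P : Polynomial (Polynomial ℂ) :=
      Polynomial.X ^ m - Polynomial.C (Polynomial.C (α ^ m) * Polynomial.X ^ n) with hP
    have hPm : P.Monic := Polynomial.monic_X_pow_sub_C _ hm.ne'
    have hψP : ψ P = (X 0) ^ m - C (α ^ m) * (X 1) ^ n := by
      have e1 : ψ Polynomial.X = X 0 := by simp [ψ]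
      have e2 : ψ (Polynomial.C Polynomial.X) = X 1 := by simp [ψ]
      have e3 : ψ (Polynomial.C (Polynomial.C α)) = C α := by simp [ψ, MvPolynomial.algebraMap_eq]
      simp only [hP, map_sub, map_mul, map_pow, e1, e2, e3]
    have hmod := Polynomial.modByMonic_add_div F P
    have hdeg : (F %ₘ P).natDegree < m := by
      have h1 : P.natDegree = m := Polynomial.natDegree_X_pow_sub_C
      have := Polynomial.natDegree_modByMonic_lt F hPm (by
        intro h; rw [h] at h1; simp at h1; omega)
      omega
    have h0 : F %ₘ P = 0 := by
      apply aux_zero m n hm hmn α hα _ hdeg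
      rw [← hφψ]
      have := hf
      rw [← hmod, map_add, map_add, map_mul, map_mul, hψP, hφp] at this
      simpa using this
    rw [← hmod, h0, zero_add, map_mul, hψP]
    exact dvd_mul_right _ _
  refine ⟨?_, ?_, ?_⟩
  · intro h
    have := congrArg (MvPolynomial.eval ![1, 0]) h
    simp [hn.ne'] at this
  · intro h
    have := h.map φ
    rw [hφp] at this
    exact not_isUnit_zero this
  · intro f g hfg
    obtain ⟨k, hk⟩ := hfg
    have := congrArg φ hk
    rw [map_mul, map_mul, hφp, zero_mul, mul_eq_zero] at this
    exact this.imp (hker f) (hker g)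

lemma aux_dvd (p : ℕ → MvPolynomial (Fin 2) ℂ) (hp : ∀ i, Prime (p i)) (s : Finset ℕ) :
    ∀ Q, Q ∣ ∏ i ∈ s, p i → ∃ c : ℂ, c ≠ 0 ∧ ∃ S ⊆ s, Q = C c * ∏ i ∈ S, p i := by
  induction s using Finset.induction_on with
  | empty =>
    intro Q hQ
    rw [Finset.prod_empty] at hQ
    obtain ⟨c, hc, rfl⟩ := MvPolynomial.isUnit_iff_eq_C_of_isReduced.mp (isUnit_of_dvd_one hQ)
    exact ⟨c, hc.ne_zero, ∅, by simp, by simp⟩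
  | insert a s has ih =>
    intro Q hQ
    rw [Finset.prod_insert has] at hQ
    obtain ⟨R, hR⟩ := hQ
    rcases (hp a).dvd_or_dvd (Dvd.intro _ hR) with ⟨T, rfl⟩ | ⟨T, rfl⟩
    · obtain ⟨c, hc, S, hS, rfl⟩ := ih T ⟨R, mul_left_cancel₀ (hp a).ne_zero (by rw [hR, mul_assoc])⟩
      refine ⟨c, hc, insert a S, Finset.insert_subset_insert a hS, ?_⟩
      rw [Finset.prod_insert (fun h => has (hS h))]; ring
    · obtain ⟨c, hc, S, hS, rfl⟩ := ih Q ⟨T, mul_left_cancel₀ (hp a).ne_zero (by rw [hR]; ring)⟩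
      exact ⟨c, hc, S, hS.trans (Finset.subset_insert a s), rfl⟩

/-- For coprime positive integers `m, n`, a positive integer `d`, and a primitive
`d`-th root of unity `ω`, we have the factorization
`x^(m*d) - y^(n*d) = ∏_{i<d} (x^m - ω^i y^n)` in `ℂ[x,y]`, and every divisor of
`x^(m*d) - y^(n*d)` is `c * ∏_{i ∈ S} (x^m - ω^i y^n)` for some `c ≠ 0` and
`S ⊆ {0, …, d-1}`. -/
theorem stmt_1 (m n d : ℕ) (hm : 0 < m) (hn : 0 < n) (hd : 0 < d)
    (hmn : Nat.Coprime m n) (ω : ℂ) (hω : IsPrimitiveRoot ω d) :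
    ((X 0) ^ (m * d) - (X 1) ^ (n * d) : MvPolynomial (Fin 2) ℂ) =
      ∏ i ∈ Finset.range d, ((X 0) ^ m - C (ω ^ i) * (X 1) ^ n) ∧
    ∀ Q : MvPolynomial (Fin 2) ℂ,
      Q ∣ ((X 0) ^ (m * d) - (X 1) ^ (n * d)) →
      ∃ c : ℂ, c ≠ 0 ∧ ∃ S ⊆ Finset.range d,
        Q = C c * ∏ i ∈ S, ((X 0) ^ m - C (ω ^ i) * (X 1) ^ n) := by
  have h1 : ((X 0) ^ (m * d) - (X 1) ^ (n * d) : MvPolynomial (Fin 2) ℂ) =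
      ∏ i ∈ Finset.range d, ((X 0) ^ m - C (ω ^ i) * (X 1) ^ n) := by
    have hζ : IsPrimitiveRoot (C ω : MvPolynomial (Fin 2) ℂ) d :=
      hω.map_of_injective (MvPolynomial.C_injective _ _)
    rw [pow_mul, pow_mul, hζ.pow_sub_pow_eq_prod_sub_mul _ _ hd]
    symm
    apply Finset.prod_nbij (fun i => (C ω : MvPolynomial (Fin 2) ℂ) ^ i)
    · intro i _
      rw [Polynomial.mem_nthRootsFinset hd, ← pow_mul, mul_comm, pow_mul, hζ.pow_eq_one, one_pow]
    · intro i hi j hj hij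
      exact hζ.pow_inj (by simpa using hi) (by simpa using hj) hij
    · intro z hz
      haveI : NeZero d := ⟨hd.ne'⟩
      have hz' := (Polynomial.mem_nthRootsFinset hd _).mp hz
      obtain ⟨i, hi, rfl⟩ := hζ.eq_pow_of_pow_eq_one hz'
      exact ⟨i, by simpa using hi, rfl⟩
    · intro i _
      simp
  refine ⟨h1, ?_⟩
  intro Q hQ
  rw [h1] at hQ
  exact aux_dvd _ (fun i => aux_prime m n hm hn hmn _ (pow_ne_zero _ (hω.ne_zero hd.ne'))) _ Q hQ
end

section
/- For every nonzero complex number ε, the polynomial x³ − y³ − ε·x² is irreducible in ℂ[x,y]. -/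
open MvPolynomial

lemma stmt_3_aux (ε : ℂ) (hε : ε ≠ 0) :
    Irreducible (Polynomial.X ^ 3 - Polynomial.C ((X 0) ^ 3 - C ε * (X 0) ^ 2) :
      Polynomial (MvPolynomial (Fin 1) ℂ)) := by
  set a : MvPolynomial (Fin 1) ℂ := (X 0) ^ 3 - C ε * (X 0) ^ 2 with ha
  have hm : (Polynomial.X ^ 3 - Polynomial.C a).Monic :=
    Polynomial.monic_X_pow_sub_C a (by norm_num)
  have hd : (Polynomial.X ^ 3 - Polynomial.C a).natDegree = 3 :=
    Polynomial.natDegree_X_pow_sub_C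
  have hP : (RingHom.ker (eval (fun _ : Fin 1 => ε))).IsPrime := RingHom.ker_isPrime _
  have haP : a ∈ RingHom.ker (eval (fun _ : Fin 1 => ε)) := by
    rw [RingHom.mem_ker]; simp [ha]; ring
  have hsq : ∀ b ∈ (RingHom.ker (eval (fun _ : Fin 1 => ε))) ^ 2,
      eval (fun _ : Fin 1 => ε) (pderiv 0 b) = 0 := by
    intro b hb
    rw [pow_two] at hb
    induction hb using Submodule.mul_induction_on' with
    | mem_mul_mem m hm n hn =>
      rw [RingHom.mem_ker] at hm hn
      simp [hm, hn]
    | add x _ y _ hx hy => simp [hx, hy]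
  refine Polynomial.irreducible_of_eisenstein_criterion hP ?_ ?_ ?_ ?_ hm.isPrimitive
  · rw [hm.leadingCoeff]
    exact fun h => hP.ne_top ((Ideal.eq_top_iff_one _).2 h)
  · intro n hn
    rw [Polynomial.degree_eq_natDegree hm.ne_zero, hd] at hn
    have hn : n < 3 := by exact_mod_cast hn
    rw [Polynomial.coeff_sub, Polynomial.coeff_X_pow, if_neg (by omega), zero_sub,
      Polynomial.coeff_C]
    apply neg_mem
    split_ifs
    · exact haP
    · exact zero_mem _
  · rw [Polynomial.degree_eq_natDegree hm.ne_zero, hd]; norm_num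
  · intro h
    have h0 : (Polynomial.X ^ 3 - Polynomial.C a).coeff 0 = -a := by
      rw [Polynomial.coeff_sub, Polynomial.coeff_X_pow, if_neg (by norm_num), zero_sub,
        Polynomial.coeff_C_zero]
    rw [h0] at h
    have := hsq _ h
    simp [ha, Derivation.leibniz_pow] at this
    apply hε
    have h2 : ε ^ 2 = 0 := by linear_combination -this
    exact pow_eq_zero_iff (by norm_num) |>.1 h2

/-- For every nonzero complex number `ε`, the polynomial `x³ - y³ - ε x²` is
irreducible in `ℂ[x,y]`. -/
theorem stmt_3 (ε : ℂ) (hε : ε ≠ 0) :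
    Irreducible ((X 0) ^ 3 - (X 1) ^ 3 - C ε * (X 0) ^ 2 :
      MvPolynomial (Fin 2) ℂ) := by
  let e := (renameEquiv ℂ (Equiv.swap (0 : Fin 2) 1)).trans (finSuccEquiv ℂ 1)
  rw [← MulEquiv.irreducible_iff e,
    ← (Associated.neg_left (Associated.refl _)).irreducible_iff]
  have h1 : finSuccEquiv ℂ 1 (X 1) = Polynomial.C (X 0) := finSuccEquiv_X_succ (j := 0)
  have hC : finSuccEquiv ℂ 1 (C ε) = Polynomial.C (C ε) := by simp [finSuccEquiv_apply]
  convert stmt_3_aux ε hε using 1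
  simp only [e, AlgEquiv.trans_apply, renameEquiv_apply, map_sub, map_mul, map_pow, rename_X,
    rename_C, Equiv.swap_apply_left, Equiv.swap_apply_right, h1, hC, finSuccEquiv_X_zero]
  ring
end

section
/- Let m, n ≥ 2 be coprime integers and let ε be a nonzero complex number. If (x,y) ∈ ℂ² satisfies the three equations x^m − y^n − ε·x·y = 0, m·x^{m−1} − ε·y = 0, and n·y^{n−1} + ε·x = 0, then x = 0 and y = 0. Equivalently, the only singular point of the affine curve x^m − y^n − εxy = 0 is the origin. -/
/-- Let `m, n ≥ 2` be coprime integers and `ε ≠ 0` a complex number. If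
`(x,y) ∈ ℂ²` satisfies `x^m - y^n - εxy = 0`, `m x^(m-1) - ε y = 0` and
`n y^(n-1) + ε x = 0`, then `x = 0` and `y = 0`: the only singular point of the
curve `x^m - y^n - εxy = 0` is the origin. -/
theorem stmt_5 (m n : ℕ) (hm : 2 ≤ m) (hn : 2 ≤ n) (hmn : Nat.Coprime m n)
    (ε : ℂ) (hε : ε ≠ 0) (x y : ℂ)
    (h1 : x ^ m - y ^ n - ε * x * y = 0)
    (h2 : (m : ℂ) * x ^ (m - 1) - ε * y = 0)
    (h3 : (n : ℂ) * y ^ (n - 1) + ε * x = 0) :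
    x = 0 ∧ y = 0 := by
  obtain ⟨a, rfl⟩ := Nat.exists_eq_add_of_le' hm
  obtain ⟨b, rfl⟩ := Nat.exists_eq_add_of_le' hn
  have e1 : a + 2 - 1 = a + 1 := rfl
  have e2 : b + 2 - 1 = b + 1 := rfl
  rw [e1] at h2
  rw [e2] at h3
  push_cast at h2 h3
  have hab : a * b + a + b ≠ 0 := by
    intro h
    have ha : a = 0 := by omega
    have hb : b = 0 := by omega
    subst ha hb
    norm_num at hmn
  have habC : ((a : ℂ) * b + a + b) ≠ 0 := by exact_mod_cast hab
  have key : ((a : ℂ) * b + a + b) * (ε * (x * y)) = 0 := by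
    linear_combination (-((a : ℂ) + 2) * (b + 2)) * h1 + ((b : ℂ) + 2) * x * h2
      - ((a : ℂ) + 2) * y * h3
  have hxy : x * y = 0 := by simpa [habC, hε] using key
  rcases mul_eq_zero.mp hxy with h | h
  · subst h
    refine ⟨rfl, ?_⟩
    simpa [hε] using h2
  · subst h
    refine ⟨?_, rfl⟩
    simpa [hε] using h3
end

section
/- Let P ∈ ℂ[x,y] be a nonzero polynomial. Then the set of complex numbers ε for which the three polynomials P, ∂P/∂x + ε·y, and ∂P/∂y + ε·x have a common nonconstant factor in ℂ[x,y] is finite. -/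
open MvPolynomial

lemma aux_not_dvd (q : MvPolynomial (Fin 2) ℂ) (hq : Irreducible q)
    (h0 : q ∣ X 0) (h1 : q ∣ X 1) : False := by
  have hX : Irreducible (X 0 : MvPolynomial (Fin 2) ℂ) := MvPolynomial.X_prime.irreducible
  have ha : Associated q (X 0) := hq.associated_of_dvd hX h0
  obtain ⟨r, hr⟩ := ha.symm.dvd.trans h1
  have := congrArg (MvPolynomial.eval ![0, 1]) hr
  simp at this

lemma aux_dvd_of_C (q Y : MvPolynomial (Fin 2) ℂ) (a b : ℂ) (hab : a ≠ b)
    (A : MvPolynomial (Fin 2) ℂ) (h1 : q ∣ A + C a * Y) (h2 : q ∣ A + C b * Y) : q ∣ Y := by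
  have h : q ∣ C (a - b) * Y := by
    have := dvd_sub h1 h2
    have e : A + C a * Y - (A + C b * Y) = C (a - b) * Y := by rw [C_sub]; ring
    rwa [e] at this
  have h3 := h.mul_left (C (a - b)⁻¹)
  rwa [← mul_assoc, ← C_mul, inv_mul_cancel₀ (sub_ne_zero.2 hab), C_1, one_mul] at h3

/-- For a nonzero `P ∈ ℂ[x,y]`, the set of `ε ∈ ℂ` such that `P`,
`∂P/∂x + ε y` and `∂P/∂y + ε x` have a common nonconstant factor is finite. -/
theorem stmt_6 (P : MvPolynomial (Fin 2) ℂ) (hP : P ≠ 0) :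
    {ε : ℂ | ∃ Q : MvPolynomial (Fin 2) ℂ, 0 < Q.totalDegree ∧
      Q ∣ P ∧ Q ∣ (pderiv 0 P + C ε * X 1) ∧ Q ∣ (pderiv 1 P + C ε * X 0)}.Finite := by
  classical
  have hfin : (⋃ q ∈ ((UniqueFactorizationMonoid.factors P).toFinset :
      Set (MvPolynomial (Fin 2) ℂ)),
      {ε : ℂ | q ∣ (pderiv 0 P + C ε * X 1) ∧ q ∣ (pderiv 1 P + C ε * X 0)}).Finite := by
    refine Set.Finite.biUnion (Finset.finite_toSet _) fun q hq => ?_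
    have hq' : Irreducible q :=
      UniqueFactorizationMonoid.irreducible_of_factor q (by simpa using hq)
    refine Set.Subsingleton.finite ?_
    rintro a ⟨ha1, ha0⟩ b ⟨hb1, hb0⟩
    by_contra hab
    exact aux_not_dvd q hq' (aux_dvd_of_C q _ a b hab _ ha0 hb0)
      (aux_dvd_of_C q _ a b hab _ ha1 hb1)
  refine hfin.subset ?_
  rintro ε ⟨Q, hdeg, hQP, h1, h0⟩
  have hQ0 : Q ≠ 0 := ne_zero_of_dvd_ne_zero hP hQP
  have hQu : ¬ IsUnit Q := by
    intro hu
    have := MvPolynomial.isUnit_iff_totalDegree_of_isReduced.1 hu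
    omega
  obtain ⟨p, hp, hpQ⟩ := WfDvdMonoid.exists_irreducible_factor hQu hQ0
  obtain ⟨q, hq, hpq⟩ := UniqueFactorizationMonoid.exists_mem_factors_of_dvd hP hp (hpQ.trans hQP)
  have hqQ : q ∣ Q := hpq.symm.dvd.trans hpQ
  exact Set.mem_biUnion (x := q) (by simpa using hq) ⟨hqQ.trans h1, hqQ.trans h0⟩
end

section
/- Let m and n be positive integers, let a, b ∈ ℂ with a ≠ b, and let u, v be nonzero complex numbers with u ≠ v. Then every point (x,y) ∈ ℂ² satisfying (x−a)^m = u·y^n and (x−b)^m = v·y^n has y ≠ 0, and the set of such points has exactly m·n elements. -/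
/-- Let `m, n` be positive integers, `a ≠ b` complex numbers, and `u, v` nonzero
complex numbers with `u ≠ v`. Then every solution `(x,y) ∈ ℂ²` of
`(x-a)^m = u y^n` and `(x-b)^m = v y^n` has `y ≠ 0`, and there are exactly
`m * n` such solutions. -/
theorem stmt_8 (m n : ℕ) (hm : 0 < m) (hn : 0 < n) (a b u v : ℂ)
    (hab : a ≠ b) (hu : u ≠ 0) (hv : v ≠ 0) (huv : u ≠ v) :
    (∀ p : ℂ × ℂ, (p.1 - a) ^ m = u * p.2 ^ n ∧ (p.1 - b) ^ m = v * p.2 ^ n →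
      p.2 ≠ 0) ∧
    {p : ℂ × ℂ | (p.1 - a) ^ m = u * p.2 ^ n ∧
      (p.1 - b) ^ m = v * p.2 ^ n}.ncard = m * n := by
  have key : ∀ p : ℂ × ℂ, (p.1 - a) ^ m = u * p.2 ^ n ∧ (p.1 - b) ^ m = v * p.2 ^ n →
      p.2 ≠ 0 := by
    rintro ⟨x, y⟩ ⟨h1, h2⟩ h
    simp only at h1 h2 h
    rw [h, zero_pow hn.ne', mul_zero] at h1 h2
    have e1 := pow_eq_zero_iff hm.ne' |>.1 h1
    have e2 := pow_eq_zero_iff hm.ne' |>.1 h2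
    exact hab (by linear_combination e2 - e1)
  refine ⟨key, ?_⟩
  obtain ⟨c, hc⟩ := IsAlgClosed.exists_pow_nat_eq (u / v) hm
  have hr : ∀ t : ℂ, ∃ r : ℂ, r ^ n = ((a - b) / (1 - t)) ^ m / v :=
    fun t => IsAlgClosed.exists_pow_nat_eq _ hn
  choose r hr using hr
  have hab' : a - b ≠ 0 := sub_ne_zero.2 hab
  have hc0 : c ≠ 0 := by
    rintro rfl
    rw [zero_pow hm.ne'] at hc
    exact div_ne_zero hu hv hc.symm
  have ht1 : ∀ t : ℂ, t ^ m = u / v → 1 - t ≠ 0 := by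
    intro t ht h
    have : t = 1 := by linear_combination -h
    rw [this, one_pow, eq_div_iff hv, one_mul] at ht
    exact huv ht.symm
  have hr0 : ∀ t : ℂ, t ^ m = u / v → r t ≠ 0 := by
    intro t ht h
    have := hr t
    rw [h, zero_pow hn.ne'] at this
    exact div_ne_zero (pow_ne_zero m (div_ne_zero hab' (ht1 t ht))) hv this.symm
  have hA := (Complex.isPrimitiveRoot_exp m hm.ne').card_nthRootsFinset
  have hB := (Complex.isPrimitiveRoot_exp n hn.ne').card_nthRootsFinset
  have htm : ∀ s : ℂ, s ^ m = 1 → (s * c) ^ m = u / v := by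
    intro s hs
    rw [mul_pow, hs, hc, one_mul]
  let f : ℂ × ℂ → ℂ × ℂ := fun q =>
    (b + (a - b) / (1 - q.1 * c), q.2 * r (q.1 * c))
  let F := Polynomial.nthRootsFinset m (1 : ℂ) ×ˢ Polynomial.nthRootsFinset n (1 : ℂ)
  have hset : {p : ℂ × ℂ | (p.1 - a) ^ m = u * p.2 ^ n ∧
      (p.1 - b) ^ m = v * p.2 ^ n} = f '' (F : Set (ℂ × ℂ)) := by
    ext ⟨x, y⟩
    simp only [Set.mem_setOf_eq, Set.mem_image, Finset.mem_coe, F, Finset.mem_product,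
      Polynomial.mem_nthRootsFinset hm, Polynomial.mem_nthRootsFinset hn, Prod.exists, f,
      Prod.mk.injEq]
    constructor
    · rintro ⟨h1, h2⟩
      have hy : y ≠ 0 := key (x, y) ⟨h1, h2⟩
      have hxb : x - b ≠ 0 := by
        intro h
        rw [h, zero_pow hm.ne'] at h2
        exact mul_ne_zero hv (pow_ne_zero n hy) h2.symm
      have ht : ((x - a) / (x - b)) ^ m = u / v := by
        rw [div_pow, h1, h2, mul_div_mul_right _ _ (pow_ne_zero n hy)]
      have hsc : (x - a) / (x - b) / c * c = (x - a) / (x - b) := div_mul_cancel₀ _ hc0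
      have e : (a - b) / (1 - (x - a) / (x - b)) = x - b := by
        rw [div_eq_iff (ht1 _ ht)]
        field_simp
        ring
      refine ⟨(x - a) / (x - b) / c, y / r ((x - a) / (x - b)), ⟨?_, ?_⟩, ?_, ?_⟩
      · rw [div_pow, ht, hc, div_self (div_ne_zero hu hv)]
      · rw [div_pow, hr, e, h2, mul_div_cancel_left₀ _ hv, div_self (pow_ne_zero n hy)]
      · rw [hsc, e]; ring
      · rw [hsc, div_mul_cancel₀ _ (hr0 _ ht)]
    · rintro ⟨s, z, ⟨hs, hz⟩, rfl, rfl⟩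
      have ht := htm s hs
      have h1 := ht1 _ ht
      generalize s * c = t at *
      have e : b + (a - b) / (1 - t) - a = t * ((a - b) / (1 - t)) := by
        field_simp
        ring
      rw [e, add_sub_cancel_left, mul_pow, mul_pow, hz, hr, ht]
      constructor <;> field_simp
  have hinj : Set.InjOn f (F : Set (ℂ × ℂ)) := by
    rintro ⟨s, z⟩ h ⟨s', z'⟩ h' he
    simp only [Finset.mem_coe, F, Finset.mem_product,
      Polynomial.mem_nthRootsFinset hm, Polynomial.mem_nthRootsFinset hn] at h h'
    simp only [f, Prod.mk.injEq] at he
    obtain ⟨e1, e2⟩ := he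
    have k := ht1 _ (htm s h.1)
    have k' := ht1 _ (htm s' h'.1)
    have e3 := add_left_cancel e1
    rw [div_eq_div_iff k k'] at e3
    have e4 := mul_left_cancel₀ hab' e3
    have e5 : s = s' := mul_right_cancel₀ hc0 (by linear_combination e4)
    subst e5
    rw [mul_right_cancel₀ (hr0 _ (htm s h.1)) e2]
  rw [hset, Set.ncard_image_of_injOn hinj, Set.ncard_coe_finset, Finset.card_product, hA, hB]
end

section
/- Let m and n be positive integers, let a, b ∈ ℂ with a ≠ b, and let u, v be nonzero complex numbers with u ≠ v. If (x,y) ∈ ℂ² satisfies (x−a)^m = u·y^n and (x−b)^m = v·y^n, then the two gradient vectors (m·(x−a)^{m−1}, −u·n·y^{n−1}) and (m·(x−b)^{m−1}, −v·n·y^{n−1}) in ℂ² are linearly independent over ℂ. -/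
/-- Let `m, n` be positive integers, `a ≠ b` complex numbers, and `u, v` nonzero
complex numbers with `u ≠ v`. If `(x,y) ∈ ℂ²` satisfies `(x-a)^m = u y^n` and
`(x-b)^m = v y^n`, then the gradients `(m (x-a)^(m-1), -u n y^(n-1))` and
`(m (x-b)^(m-1), -v n y^(n-1))` are linearly independent over `ℂ`. -/
theorem stmt_9 (m n : ℕ) (hm : 0 < m) (hn : 0 < n) (a b u v : ℂ)
    (hab : a ≠ b) (hu : u ≠ 0) (hv : v ≠ 0) (huv : u ≠ v) (x y : ℂ)
    (h1 : (x - a) ^ m = u * y ^ n) (h2 : (x - b) ^ m = v * y ^ n) :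
    LinearIndependent ℂ
      ![(((m : ℂ) * (x - a) ^ (m - 1), -u * n * y ^ (n - 1)) : ℂ × ℂ),
        (((m : ℂ) * (x - b) ^ (m - 1), -v * n * y ^ (n - 1)) : ℂ × ℂ)] := by
  have hy : y ≠ 0 := by
    rintro rfl
    rw [zero_pow hn.ne', mul_zero] at h1 h2
    have e1 := pow_eq_zero_iff hm.ne' |>.1 h1
    have e2 := pow_eq_zero_iff hm.ne' |>.1 h2
    exact hab (by linear_combination e2 - e1)
  have hmC : (m : ℂ) ≠ 0 := Nat.cast_ne_zero.2 hm.ne'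
  have hnC : (n : ℂ) ≠ 0 := Nat.cast_ne_zero.2 hn.ne'
  have hyn : y ^ n ≠ 0 := pow_ne_zero _ hy
  have hX : (x - a) ^ (m - 1) * (x - a) = u * y ^ n := by
    rw [← h1, ← pow_succ, Nat.sub_add_cancel hm]
  have hY : (x - b) ^ (m - 1) * (x - b) = v * y ^ n := by
    rw [← h2, ← pow_succ, Nat.sub_add_cancel hm]
  rw [LinearIndependent.pair_iff]
  intro s t hst
  rw [Prod.ext_iff] at hst
  obtain ⟨p, q⟩ := hst
  simp only [Prod.fst_add, Prod.snd_add, Prod.smul_mk, smul_eq_mul, Prod.fst_zero,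
    Prod.snd_zero] at p q
  have p' : s * (x - a) ^ (m - 1) + t * (x - b) ^ (m - 1) = 0 := by
    apply mul_left_cancel₀ hmC
    linear_combination p
  have q' : s * u + t * v = 0 := by
    apply mul_left_cancel₀ (mul_ne_zero hnC (pow_ne_zero (n - 1) hy))
    linear_combination -q
  have key : (s * u) * (y ^ n * (a - b)) = 0 := by
    linear_combination (x - a) * (x - b) * p' - s * (x - b) * hX - t * (x - a) * hY
      - y ^ n * (x - a) * q'
  have hs : s = 0 := by
    have := (mul_eq_zero.1 key).resolve_right (mul_ne_zero hyn (sub_ne_zero.2 hab))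
    exact (mul_eq_zero.1 this).resolve_right hu
  subst hs
  refine ⟨rfl, ?_⟩
  rw [zero_mul, zero_add] at q'
  exact (mul_eq_zero.1 q').resolve_right hv
end

section
/- Let A ∈ ℂ[x] be a nonzero polynomial with A(0) ≠ 0, let c ∈ ℂ, let ε₀ be a nonzero complex number, and let p ≥ 1 and q ≥ 2 be integers. Suppose the one-variable polynomial A(x)^q · x^p · (1 − 1/q)^{q−1} − q·(A(x)·(x+c) + ε₀)^{q−1} is not identically zero. Then the set of points (x,y) ∈ ℂ² satisfying both (A(x)·(x − y + c) + ε₀)·x^p + y^q = 0 and −A(x)·x^p + q·y^{q−1} = 0 is finite. -/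
open Polynomial

/-- Let `A ∈ ℂ[x]` be nonzero with `A(0) ≠ 0`, let `c ∈ ℂ`, `ε₀ ≠ 0`, and let
`p ≥ 1`, `q ≥ 2` be integers. If the one-variable polynomial
`A^q x^p (1 - 1/q)^(q-1) - q (A (x+c) + ε₀)^(q-1)` is not identically zero,
then the set of `(x,y) ∈ ℂ²` with `(A(x)(x - y + c) + ε₀) x^p + y^q = 0` and
`-A(x) x^p + q y^(q-1) = 0` is finite. -/
theorem stmt_10 (A : Polynomial ℂ) (hA : A ≠ 0) (hA0 : A.eval 0 ≠ 0)
    (c ε₀ : ℂ) (hε₀ : ε₀ ≠ 0) (p q : ℕ) (hp : 1 ≤ p) (hq : 2 ≤ q)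
    (hne : A ^ q * X ^ p * C ((1 - 1 / (q : ℂ)) ^ (q - 1)) -
        C (q : ℂ) * (A * (X + C c) + C ε₀) ^ (q - 1) ≠ 0) :
    {z : ℂ × ℂ | (A.eval z.1 * (z.1 - z.2 + c) + ε₀) * z.1 ^ p + z.2 ^ q = 0 ∧
      -A.eval z.1 * z.1 ^ p + (q : ℂ) * z.2 ^ (q - 1) = 0}.Finite := by
  have hq0 : (q : ℂ) ≠ 0 := by
    have : q ≠ 0 := by omega
    exact_mod_cast this
  set P := A ^ q * X ^ p * C ((1 - 1 / (q : ℂ)) ^ (q - 1)) -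
        C (q : ℂ) * (A * (X + C c) + C ε₀) ^ (q - 1) with hP
  have hS : ({x : ℂ | x = 0} ∪ {x : ℂ | P.IsRoot x}).Finite :=
    (Set.finite_singleton (0 : ℂ)).union (Polynomial.finite_setOfPred_isRoot hne)
  have hF : ∀ x : ℂ, {y : ℂ | y ∈ Polynomial.nthRoots (q - 1) (A.eval x * x ^ p / q)}.Finite :=
    fun x => Multiset.finite_toSet _
  refine (hS.biUnion (fun x _ => (Set.finite_singleton x).prod (hF x))).subset ?_
  rintro ⟨x, y⟩ ⟨h1, h2⟩
  simp only at h1 h2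
  obtain ⟨n, rfl⟩ : ∃ n, q = n + 1 := ⟨q - 1, by omega⟩
  simp only [Nat.add_sub_cancel] at *
  simp only [Set.mem_iUnion]
  refine ⟨x, ?_, ?_⟩
  · by_cases hx : x = 0
    · exact Or.inl hx
    · right
      have hxp : x ^ p ≠ 0 := pow_ne_zero _ hx
      have hB : A.eval x * (x + c) + ε₀ = (1 - 1 / ((n + 1 : ℕ) : ℂ)) * (A.eval x * y) := by
        apply mul_right_cancel₀ hxp
        apply mul_left_cancel₀ hq0
        rw [pow_succ] at h1
        have hi : ((n + 1 : ℕ) : ℂ) * (1 / ((n + 1 : ℕ) : ℂ)) = 1 := by field_simp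
        linear_combination ((n + 1 : ℕ) : ℂ) * h1 - y * h2 + A.eval x * y * x ^ p * hi
      show P.eval x = 0
      simp only [hP, eval_sub, eval_mul, eval_pow, eval_X, eval_C, eval_add]
      rw [hB, mul_pow, mul_pow, pow_succ]
      linear_combination (-(1 - 1 / ((n + 1 : ℕ) : ℂ)) ^ n * A.eval x ^ n) * h2
  · refine ⟨rfl, ?_⟩
    show y ∈ Polynomial.nthRoots n _
    rw [Polynomial.mem_nthRoots (by omega), eq_div_iff hq0]
    linear_combination h2
end
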